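/- Let f = Σ_{j=0}^{n} b_j·X^{α(j)} + c·X^{y} be a circuit polynomial (as a polynomial in ℝ[X_1,…,X_n]) and assume Δ is an H-simplex, i.e. every lattice point β ∈ (Δ ∩ ℤⁿ) \ {α(0),…,α(n)} can be written as β = (s + t)/2 for two distinct points s, t ∈ Δ ∩ (2ℤ)ⁿ. Then f is nonnegative on ℝⁿ if and only if f is a sum of squares of polynomials. -/

import Mathlib

open MvPolynomial

theorem eq_single_of_mem_stdSimplex {ι : Type*} [Fintype ι] [DecidableEq ι] {μ : ι → ℝ}
    (hμ : μ ∈ stdSimplex ℝ ι) {i : ι} (hi : 1 ≤ μ i) : μ = Pi.single i 1 := by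
  have hsum := Finset.add_sum_erase Finset.univ μ (Finset.mem_univ i)
  rw [hμ.2] at hsum
  have hnonneg : ∀ j ∈ Finset.univ.erase i, 0 ≤ μ j := fun j _ => hμ.1 j
  have hrest := Finset.sum_nonneg hnonneg
  have hzero := (Finset.sum_eq_zero_iff_of_nonneg hnonneg).1 (by linarith)
  funext j
  by_cases hj : j = i
  · subst hj
    rw [Pi.single_eq_same]
    linarith
  · rw [Pi.single_eq_of_ne hj]
    exact hzero j (by simp [hj])

/-- Removing the loop at `i` from a probability vector and renormalising. -/
theorem exists_stdSimplex_removeLoop {ι V M : Type*} [Fintype ι]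
    [AddCommGroup V] [Module ℝ V] [AddCommGroup M] [Module ℝ M] (Q : PointedCone ℝ M)
    (p : ι → V) (e : ι → M) {ν : ι → ℝ} (hν : ν ∈ stdSimplex ℝ ι) {i : ι} (hi : ν i < 1)
    (hp : Fintype.linearCombination ℝ p ν = p i)
    (he : Fintype.linearCombination ℝ e ν - e i ∈ Q) :
    ∃ ρ ∈ stdSimplex ℝ ι, ρ i = 0 ∧ (∀ j, ν j = 0 → ρ j = 0) ∧
      Fintype.linearCombination ℝ p ρ = p i ∧
      Fintype.linearCombination ℝ e ρ - e i ∈ Q := by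
  classical
  have hpos : 0 < 1 - ν i := by linarith
  have hinv : (1 - ν i)⁻¹ * (1 - ν i) = 1 := inv_mul_cancel₀ hpos.ne'
  refine ⟨(1 - ν i)⁻¹ • (ν - Pi.single i (ν i)), ⟨fun j => ?_, ?_⟩, by simp, fun j hj => ?_,
    ?_, ?_⟩
  · rw [Pi.smul_apply, Pi.sub_apply, smul_eq_mul]
    refine mul_nonneg (inv_nonneg.2 hpos.le) ?_
    by_cases hj : j = i
    · subst hj; simp
    · simp [hj, hν.1 j]
  · simp only [Pi.smul_apply, Pi.sub_apply, smul_eq_mul, ← Finset.mul_sum,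
      Finset.sum_sub_distrib, hν.2, Finset.sum_pi_single', Finset.mem_univ, if_true]
    simp [hpos.ne']
  · by_cases hji : j = i
    · subst hji; simp
    · simp [hji, hj]
  · rw [map_smul, map_sub, hp, Fintype.linearCombination_apply_single]
    nth_rewrite 1 [← one_smul ℝ (p i)]
    rw [← sub_smul, smul_smul, hinv, one_smul]
  · have key : Fintype.linearCombination ℝ e ((1 - ν i)⁻¹ • (ν - Pi.single i (ν i))) - e i =
        (1 - ν i)⁻¹ • (Fintype.linearCombination ℝ e ν - e i) := by
      rw [map_smul, map_sub, Fintype.linearCombination_apply_single]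
      nth_rewrite 2 [show e i = ((1 - ν i)⁻¹ * (1 - ν i)) • e i by rw [hinv, one_smul]]
      module
    rw [key]
    exact Q.smul_mem (inv_nonneg.2 hpos.le) he

/-- If every point indexed by `N` is the midpoint of two distinct points, in a way compatible with
the order defined by the cone `Q`, then every point is a barycentre, compatibly with this order,
of points indexed outside `N`. -/
theorem exists_barycentre_off_midpoints {ι V M : Type*} [Fintype ι]
    [AddCommGroup V] [Module ℝ V] [AddCommGroup M] [Module ℝ M] (Q : PointedCone ℝ M)
    (p : ι → V) (e : ι → M) (N : Finset ι)
    (hN : ∀ i ∈ N, ∃ s t, p s ≠ p t ∧ p i = (1 / 2 : ℝ) • p s + (1 / 2 : ℝ) • p t ∧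
      (1 / 2 : ℝ) • e s + (1 / 2 : ℝ) • e t - e i ∈ Q) (k : ι) :
    ∃ μ ∈ stdSimplex ℝ ι, (∀ j ∈ N, μ j = 0) ∧ Fintype.linearCombination ℝ p μ = p k ∧
      Fintype.linearCombination ℝ e μ - e k ∈ Q := by
  classical
  induction N using Finset.induction_on generalizing k with
  | empty =>
    exact ⟨Pi.single k 1, single_mem_stdSimplex ℝ k, by simp,
      by simp [Fintype.linearCombination_apply_single],
      by simp [Fintype.linearCombination_apply_single]⟩
  | insert i N hi ih =>
    have ih' := ih fun j hj => hN j (Finset.mem_insert_of_mem hj)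
    obtain ⟨s, t, hst, hmid, hQ⟩ := hN i (Finset.mem_insert_self i N)
    obtain ⟨μs, hμs, hsN, hsp, hse⟩ := ih' s
    obtain ⟨μt, hμt, htN, htp, hte⟩ := ih' t
    have hν : (1 / 2 : ℝ) • μs + (1 / 2 : ℝ) • μt ∈ stdSimplex ℝ ι :=
      convex_stdSimplex ℝ ι hμs hμt (by norm_num) (by norm_num) (by norm_num)
    have hlt : ((1 / 2 : ℝ) • μs + (1 / 2 : ℝ) • μt) i < 1 := by
      by_contra! hge
      have hs1 : μs i ≤ 1 := (mem_Icc_of_mem_stdSimplex hμs i).2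
      have ht1 : μt i ≤ 1 := (mem_Icc_of_mem_stdSimplex hμt i).2
      simp only [Pi.add_apply, Pi.smul_apply, smul_eq_mul] at hge
      apply hst
      rw [← hsp, ← htp, eq_single_of_mem_stdSimplex hμs (i := i) (by linarith),
        eq_single_of_mem_stdSimplex hμt (i := i) (by linarith)]
    obtain ⟨ρ, hρ, hρi, hρN, hρp, hρe⟩ := exists_stdSimplex_removeLoop Q p e hν hlt
      (by rw [map_add, map_smul, map_smul, hsp, htp, hmid]) (by
        have h2 := Q.add_mem (Q.smul_mem (by norm_num : (0 : ℝ) ≤ 1 / 2) hse)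
          (Q.smul_mem (by norm_num : (0 : ℝ) ≤ 1 / 2) hte)
        have h3 := Q.add_mem h2 hQ
        convert h3 using 1
        rw [map_add, map_smul, map_smul]
        module)
    obtain ⟨μ, hμ, hμN, hμp, hμe⟩ := ih' k
    refine ⟨μ + μ i • (ρ - Pi.single i 1), ⟨fun j => ?_, ?_⟩, fun j hj => ?_, ?_, ?_⟩
    · by_cases hj : j = i
      · subst hj; simp [hρi]
      · simpa [hj] using add_nonneg (hμ.1 j) (mul_nonneg (hμ.1 i) (hρ.1 j))
    · simp only [Pi.add_apply, Pi.smul_apply, Pi.sub_apply, smul_eq_mul, Finset.sum_add_distrib,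
        ← Finset.mul_sum, Finset.sum_sub_distrib, hμ.2, hρ.2, Finset.sum_pi_single',
        Finset.mem_univ, if_true]
      simp
    · rcases Finset.mem_insert.1 hj with rfl | hj
      · simp [hρi]
      · have hji : j ≠ i := fun h => hi (h ▸ hj)
        simp [hji, hμN j hj, hρN j (by simp [hsN j hj, htN j hj])]
    · rw [map_add, map_smul, map_sub, hμp, hρp, Fintype.linearCombination_apply_single]
      simp
    · have h2 := Q.add_mem hμe (Q.smul_mem (hμ.1 i) hρe)
      convert h2 using 1
      rw [map_add, map_smul, map_sub, Fintype.linearCombination_apply_single]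
      module

/-- The cone of sums of squares in a real algebra. -/
def sumSqCone (A : Type*) [CommRing A] [Algebra ℝ A] : PointedCone ℝ A where
  __ := AddSubmonoid.sumSq A
  smul_mem' r a ha := by
    have h : r • a = algebraMap ℝ A (√r) * algebraMap ℝ A (√r) * a := by
      rw [← map_mul, Real.mul_self_sqrt r.2, ← Algebra.smul_def]
      rfl
    rw [h]
    exact (IsSumSq.mul_self _).mul ha

theorem IsSumSq.smul_nonneg {A : Type*} [CommRing A] [Algebra ℝ A] {a : A} (ha : IsSumSq a)
    {r : ℝ} (hr : 0 ≤ r) : IsSumSq (r • a) :=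
  (sumSqCone A).smul_mem hr ha

theorem IsSumSq.map {F A B : Type*} [CommRing A] [CommRing B] [FunLike F A B]
    [RingHomClass F A B] (φ : F) {a : A} (ha : IsSumSq a) : IsSumSq (φ a) := by
  induction ha with
  | zero => simp
  | sq_add a _ ih =>
    rw [map_add, map_mul]
    exact (IsSumSq.mul_self _).add ih

theorem isSumSq_iff_exists_sum_sq {A : Type*} [CommRing A] {a : A} :
    IsSumSq a ↔ ∃ (m : ℕ) (q : Fin m → A), a = ∑ i, q i ^ 2 := by
  constructor
  · intro ha
    induction ha with
    | zero => exact ⟨0, Fin.elim0, by simp⟩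
    | sq_add a _ ih =>
      obtain ⟨m, q, hq⟩ := ih
      exact ⟨m + 1, Fin.cons a q, by simp [Fin.sum_univ_succ, hq, sq]⟩
  · rintro ⟨m, q, rfl⟩
    exact IsSumSq.sum_sq Finset.univ q

/-- Affine functions take arbitrary prescribed values at affinely independent points. -/
theorem AffineIndependent.exists_dotProduct_add_eq {κ ι : Type*} [Fintype κ] [Fintype ι]
    {p : ι → κ → ℝ} (hp : AffineIndependent ℝ p) (r : ι → ℝ) :
    ∃ (v : κ → ℝ) (k : ℝ), ∀ j, ∑ i, p j i * v i + k = r j := by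
  classical
  have hker : (Fintype.linearCombination ℝ fun j => (p j, (1 : ℝ))).ker = ⊥ := by
    refine LinearMap.ker_eq_bot'.2 fun w hw => ?_
    rw [Fintype.linearCombination_apply, Prod.ext_iff, Prod.fst_sum, Prod.snd_sum] at hw
    funext j
    exact affineIndependent_iff.1 hp Finset.univ w (by simpa using hw.2) (by simpa using hw.1) j
      (Finset.mem_univ j)
  obtain ⟨g, hg⟩ := LinearMap.exists_leftInverse_of_injective _ hker
  let φ := Fintype.linearCombination ℝ r ∘ₗ g
  have hφ : ∀ j, φ (p j, 1) = r j := fun j => by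
    have h := LinearMap.congr_fun hg (Pi.single j 1)
    rw [LinearMap.comp_apply, Fintype.linearCombination_apply_single, one_smul,
      LinearMap.id_apply] at h
    rw [LinearMap.comp_apply, h, Fintype.linearCombination_apply_single, one_smul]
  refine ⟨fun i => φ (fun j => if i = j then 1 else 0, 0), φ (0, 1), fun j => ?_⟩
  rw [← hφ j, show (p j, (1 : ℝ)) = LinearMap.inl ℝ (κ → ℝ) ℝ (p j) + (0, 1) by simp, map_add,
    ← LinearMap.comp_apply, LinearMap.pi_apply_eq_sum_univ]
  simp

/-- The monomial with coefficient one and exponent vector `a`. -/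
noncomputable abbrev MvPolynomial.xpow {n : ℕ} (a : Fin n → ℕ) : MvPolynomial (Fin n) ℝ :=
  ∏ i, X i ^ a i

theorem MvPolynomial.xpow_add {n : ℕ} (a b : Fin n → ℕ) : xpow (a + b) = xpow a * xpow b := by
  simp [xpow, pow_add, Finset.prod_mul_distrib]

theorem MvPolynomial.isSumSq_xpow {n : ℕ} {a : Fin n → ℕ} (ha : ∀ i, Even (a i)) :
    IsSumSq (xpow a) :=
  IsSumSq.prod fun i _ => ((ha i).isSquare_pow _).isSumSq

theorem MvPolynomial.aeval_scale_xpow {n : ℕ} (x : Fin n → ℝ) (a : Fin n → ℕ) :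
    aeval (fun i => x i • (X i : MvPolynomial (Fin n) ℝ)) (xpow a) =
      (∏ i, x i ^ a i) • xpow a := by
  simp [xpow, smul_eq_C_mul, mul_pow, Finset.prod_mul_distrib]

/-- Half the square of a difference of two monomials. -/
theorem MvPolynomial.isSumSq_midpoint_sub {n : ℕ} {s t a : Fin n → ℕ} (hs : ∀ i, Even (s i))
    (ht : ∀ i, Even (t i)) (ha : ∀ i, 2 * a i = s i + t i) :
    IsSumSq ((1 / 2 : ℝ) • xpow s + (1 / 2 : ℝ) • xpow t - xpow a) := by
  choose s' hs' using hs
  choose t' ht' using ht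
  obtain rfl : s = s' + s' := _root_.funext hs'
  obtain rfl : t = t' + t' := _root_.funext ht'
  obtain rfl : a = s' + t' := _root_.funext fun i => by
    have := ha i
    simp only [Pi.add_apply] at this ⊢
    omega
  have h : (1 / 2 : ℝ) • xpow (s' + s') + (1 / 2 : ℝ) • xpow (t' + t') - xpow (s' + t') =
      (1 / 2 : ℝ) • ((xpow s' - xpow t') * (xpow s' - xpow t')) := by
    rw [xpow_add, xpow_add, xpow_add, show (xpow s' - xpow t') * (xpow s' - xpow t') =
      xpow s' * xpow s' + xpow t' * xpow t' - (2 : ℝ) • (xpow s' * xpow t') by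
        rw [two_smul]; ring]
    module
  rw [h]
  exact (IsSumSq.mul_self _).smul_nonneg (by norm_num)

theorem finite_natCast_mem_convexHull {κ ι : Type*} [Fintype κ] [Fintype ι]
    (α : ι → κ → ℕ) :
    {a : κ → ℕ | (fun i => (a i : ℝ)) ∈
      convexHull ℝ (Set.range fun j i => (α j i : ℝ))}.Finite := by
  classical
  refine (Set.finite_Icc (0 : κ → ℕ) (fun i => ∑ j, α j i)).subset fun a ha => ⟨zero_le, ?_⟩
  have h := convexHull_min (t := Set.Iic fun i => ((∑ j, α j i : ℕ) : ℝ)) ?_ (convex_Iic _) ha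
  · exact fun i => Nat.cast_le.1 (h i)
  · rintro _ ⟨j, rfl⟩ i
    exact Nat.cast_le.2 <| Finset.single_le_sum (f := fun j => α j i) (fun _ _ => Nat.zero_le _)
      (Finset.mem_univ j)

theorem exists_natCast_of_mem_convexHull {κ ι : Type*} {α : ι → κ → ℕ} {s : κ → ℤ}
    (hs : (fun i => (s i : ℝ)) ∈ convexHull ℝ (Set.range fun j i => (α j i : ℝ))) :
    ∃ a : κ → ℕ, s = fun i => (a i : ℤ) := by
  have h := convexHull_min (t := Set.Ici (0 : κ → ℝ)) ?_ (convex_Ici _) hs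
  · refine ⟨fun i => (s i).toNat, funext fun i => (Int.toNat_of_nonneg ?_).symm⟩
    exact Int.cast_nonneg_iff.1 (h i)
  · rintro _ ⟨j, rfl⟩ i
    positivity

/-- The simplicial agiform of a lattice point of an `H`-simplex is a sum of squares. -/
theorem MvPolynomial.isSumSq_agiform {n : ℕ} {ι : Type*} [Fintype ι] (α : ι → Fin n → ℕ)
    (haff : AffineIndependent ℝ fun j i => (α j i : ℝ))
    (hH : ∀ β : Fin n → ℤ,
      (fun i => (β i : ℝ)) ∈ convexHull ℝ (Set.range fun j i => (α j i : ℝ)) →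
      (∀ j, β ≠ fun i => (α j i : ℤ)) →
      ∃ s t : Fin n → ℤ, s ≠ t ∧ (∀ i, Even (s i)) ∧ (∀ i, Even (t i)) ∧
        (fun i => (s i : ℝ)) ∈ convexHull ℝ (Set.range fun j i => (α j i : ℝ)) ∧
        (fun i => (t i : ℝ)) ∈ convexHull ℝ (Set.range fun j i => (α j i : ℝ)) ∧
        ∀ i, 2 * β i = s i + t i)
    (y : Fin n → ℕ) (lam : ι → ℝ) (hlam : ∀ j, 0 ≤ lam j) (hlamsum : ∑ j, lam j = 1)
    (hy : ∀ i, (y i : ℝ) = ∑ j, lam j * (α j i : ℝ)) :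
    IsSumSq (∑ j, lam j • xpow (α j) - xpow y) := by
  classical
  let L := {a : Fin n → ℕ // (fun i => (a i : ℝ)) ∈
    convexHull ℝ (Set.range fun j i => (α j i : ℝ))}
  let _ : Fintype L := (finite_natCast_mem_convexHull α).fintype
  let p : L → Fin n → ℝ := fun a i => a.1 i
  let e : L → MvPolynomial (Fin n) ℝ := fun a => xpow a.1
  let v : ι → L := fun j => ⟨α j, subset_convexHull ℝ _ ⟨j, rfl⟩⟩
  have hp : Function.Injective p := fun a b h =>
    Subtype.ext (_root_.funext fun i => Nat.cast_injective (congrFun h i))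
  have hv : Function.Injective v := fun j k h =>
    haff.injective (congrArg p h)
  have hyL : (fun i => (y i : ℝ)) ∈ convexHull ℝ (Set.range fun j i => (α j i : ℝ)) := by
    have h := (convex_convexHull ℝ (Set.range fun j i => (α j i : ℝ))).sum_mem
      (t := Finset.univ) (fun j _ => hlam j) hlamsum
      (fun j _ => subset_convexHull ℝ _ (Set.mem_range_self j))
    convert h using 1
    funext i
    simp [hy i]
  obtain ⟨μ, hμ, hμN, hμp, hμe⟩ := exists_barycentre_off_midpoints (sumSqCone _) p e
    (Finset.univ.filter fun a => a ∉ Set.range v) (fun a ha => by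
      obtain ⟨s, t, hst, hs, ht, hsL, htL, hmid⟩ := hH (fun i => (a.1 i : ℤ))
        (by simpa using a.2) (fun j h => (Finset.mem_filter.1 ha).2
          ⟨j, Subtype.ext (_root_.funext fun i => Nat.cast_injective (congrFun h i).symm)⟩)
      obtain ⟨s, rfl⟩ := exists_natCast_of_mem_convexHull hsL
      obtain ⟨t, rfl⟩ := exists_natCast_of_mem_convexHull htL
      have hmid' : ∀ i, 2 * a.1 i = s i + t i := fun i => by
        have := hmid i
        dsimp only at this
        exact_mod_cast this
      refine ⟨⟨s, by simpa using hsL⟩, ⟨t, by simpa using htL⟩, fun h => hst ?_, ?_, ?_⟩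
      · have h2 : s = t := congrArg Subtype.val (hp h)
        rw [h2]
      · funext i
        have h2 : (2 * (a.1 i) : ℝ) = s i + t i := by exact_mod_cast hmid' i
        simp only [p, Pi.add_apply, Pi.smul_apply, smul_eq_mul]
        linarith
      · exact isSumSq_midpoint_sub (fun i => (Int.even_coe_nat _).1 (hs i))
          (fun i => (Int.even_coe_nat _).1 (ht i)) hmid') ⟨y, hyL⟩
  have hoff : ∀ a ∉ Set.range v, μ a = 0 := fun a ha => hμN a (by simpa using ha)
  have hsum : ∑ j, μ (v j) = 1 := by
    rw [← hμ.2]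
    exact Fintype.sum_of_injective v hv _ _ hoff fun _ => rfl
  have hpsum : ∑ j, μ (v j) • p (v j) = fun i => (y i : ℝ) := by
    rw [← show Fintype.linearCombination ℝ p μ = fun i => (y i : ℝ) from hμp,
      Fintype.linearCombination_apply]
    exact Fintype.sum_of_injective v hv _ _ (fun a ha => by simp [hoff a ha]) fun _ => rfl
  have hesum : ∑ j, μ (v j) • xpow (α j) = Fintype.linearCombination ℝ e μ := by
    rw [Fintype.linearCombination_apply]
    exact Fintype.sum_of_injective v hv _ _ (fun a ha => by simp [hoff a ha]) fun _ => rfl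
  have hμlam : ∀ j, μ (v j) = lam j := fun j => by
    refine sub_eq_zero.1 (affineIndependent_iff.1 haff Finset.univ (fun j => μ (v j) - lam j)
      ?_ ?_ j (Finset.mem_univ j))
    · rw [Finset.sum_sub_distrib, hsum, hlamsum, sub_self]
    · simp only [sub_smul, Finset.sum_sub_distrib]
      rw [sub_eq_zero]
      refine hpsum.trans (_root_.funext fun i => ?_)
      simp [hy i]
  simp only [hμlam] at hesum
  rw [hesum]
  exact hμe

/-- A term that is not a monomial square is negative at some sign vector. -/
theorem exists_sign_of_not_even {n : ℕ} {c : ℝ} (hc : c ≠ 0) {y : Fin n → ℕ}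
    (h : ¬ (0 < c ∧ ∀ i, Even (y i))) :
    ∃ ε : Fin n → ℝ, (∀ i, ε i ^ 2 = 1) ∧ c * ∏ i, ε i ^ y i < 0 := by
  classical
  rcases hc.lt_or_gt with hneg | hpos
  · exact ⟨1, by simp, by simpa using hneg⟩
  · obtain ⟨k, hk⟩ : ∃ k, ¬ Even (y k) := by simpa [hpos] using h
    refine ⟨Function.update 1 k (-1), fun i => ?_, ?_⟩
    · by_cases hi : i = k
      · subst hi; simp
      · simp [hi]
    · rw [Finset.prod_eq_single k (fun i _ hi => by simp [hi]) (by simp),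
        Function.update_self, (Nat.not_even_iff_odd.1 hk).neg_one_pow]
      linarith

/-- A point at which all the vertex terms are proportional to the barycentric coordinates, with
prescribed signs of its coordinates. -/
theorem exists_equalizing_point {n : ℕ} {ι : Type*} [Fintype ι] {α : ι → Fin n → ℕ}
    (hαeven : ∀ j i, Even (α j i)) (haff : AffineIndependent ℝ fun j i => (α j i : ℝ))
    {b lam : ι → ℝ} (hb : ∀ j, 0 < b j) (hlam : ∀ j, 0 < lam j)
    {ε : Fin n → ℝ} (hε : ∀ i, ε i ^ 2 = 1) :
    ∃ (r : Fin n → ℝ) (K : ℝ), (∀ i, 0 < r i) ∧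
      ∀ j, b j * ∏ i, (ε i * r i) ^ α j i = K * lam j := by
  obtain ⟨v, k, hv⟩ := haff.exists_dotProduct_add_eq fun j => Real.log (lam j / b j)
  refine ⟨fun i => Real.exp (v i), Real.exp (-k), fun i => Real.exp_pos _, fun j => ?_⟩
  have hprod : ∏ i, (ε i * Real.exp (v i)) ^ α j i = Real.exp (∑ i, (α j i : ℝ) * v i) := by
    rw [Real.exp_sum]
    refine Finset.prod_congr rfl fun i _ => ?_
    obtain ⟨m, hm⟩ := hαeven j i
    rw [mul_pow, ← Real.exp_nat_mul, hm, ← two_mul, pow_mul, hε, one_pow, one_mul]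
  rw [hprod, eq_sub_of_add_eq (hv j), sub_eq_add_neg, Real.exp_add,
    Real.exp_log (div_pos (hlam j) (hb j))]
  field_simp [(hb j).ne']

/-- For a circuit polynomial `f` whose Newton simplex `Δ` is an
`H`-simplex (every non-vertex lattice point of `Δ` is a midpoint of two distinct even
lattice points of `Δ`), nonnegativity of `f` is equivalent to being a sum of squares. -/
theorem circuit_poly_H_simplex_nonneg_iff_sos
    (n : ℕ) (hn : 1 ≤ n)
    (α : Fin (n + 1) → Fin n → ℕ)
    (hαeven : ∀ j i, Even (α j i))
    (haff : AffineIndependent ℝ (fun j : Fin (n + 1) => (fun i : Fin n => (α j i : ℝ))))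
    (b : Fin (n + 1) → ℝ) (hb : ∀ j, 0 < b j)
    (c : ℝ) (hc : c ≠ 0)
    (y : Fin n → ℕ)
    (lam : Fin (n + 1) → ℝ) (hlam : ∀ j, 0 < lam j)
    (hlamsum : ∑ j, lam j = 1)
    (hy : ∀ i, (y i : ℝ) = ∑ j, lam j * (α j i : ℝ))
    -- `Δ` is an `H`-simplex:
    (hH : ∀ β : Fin n → ℤ,
      ((fun i => (β i : ℝ)) ∈
        convexHull ℝ (Set.range (fun j : Fin (n + 1) => fun i : Fin n => (α j i : ℝ)))) →
      (∀ j, β ≠ (fun i => (α j i : ℤ))) →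
      ∃ s t : Fin n → ℤ, s ≠ t ∧
        (∀ i, Even (s i)) ∧ (∀ i, Even (t i)) ∧
        ((fun i => (s i : ℝ)) ∈
          convexHull ℝ (Set.range (fun j : Fin (n + 1) => fun i : Fin n => (α j i : ℝ)))) ∧
        ((fun i => (t i : ℝ)) ∈
          convexHull ℝ (Set.range (fun j : Fin (n + 1) => fun i : Fin n => (α j i : ℝ)))) ∧
        ∀ i, 2 * β i = s i + t i)
    (f : MvPolynomial (Fin n) ℝ)
    (hf : f = ∑ j, C (b j) * ∏ i, X i ^ α j i + C c * ∏ i, X i ^ y i) :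
    (∀ x : Fin n → ℝ, 0 ≤ eval x f) ↔
      ∃ (m : ℕ) (q : Fin m → MvPolynomial (Fin n) ℝ), f = ∑ i, q i ^ 2 := by
  constructor
  · intro hnonneg
    rw [← isSumSq_iff_exists_sum_sq]
    have hf' : f = ∑ j, b j • xpow (α j) + c • xpow y := by
      simp only [hf, smul_eq_C_mul]
    by_cases hpos : 0 < c ∧ ∀ i, Even (y i)
    · rw [hf']
      exact (IsSumSq.sum fun j _ => (isSumSq_xpow (hαeven j)).smul_nonneg (hb j).le).add
        ((isSumSq_xpow hpos.2).smul_nonneg hpos.1.le)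
    obtain ⟨ε, hε, hεneg⟩ := exists_sign_of_not_even hc hpos
    obtain ⟨r, K, hr, hK⟩ := exists_equalizing_point hαeven haff hb hlam hε
    set x : Fin n → ℝ := fun i => ε i * r i with hx
    have hKx : ∀ j, b j * ∏ i, x i ^ α j i = K * lam j := hK
    have hxne : ∀ i, x i ≠ 0 := fun i =>
      mul_ne_zero (fun h => by simpa [h] using hε i) (hr i).ne'
    have hxpow : ∀ a : Fin n → ℕ, ∏ i, x i ^ a i ≠ 0 := fun a =>
      Finset.prod_ne_zero_iff.2 fun i _ => pow_ne_zero _ (hxne i)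
    set t : ℝ := -(c * ∏ i, x i ^ y i) with ht
    have htpos : 0 < t := by
      rw [ht, neg_pos]
      simp only [hx, mul_pow, Finset.prod_mul_distrib, ← mul_assoc]
      exact mul_neg_of_neg_of_pos hεneg (Finset.prod_pos fun i _ => pow_pos (hr i) _)
    have htK : t ≤ K := by
      have h := hnonneg x
      simp only [hf, map_add, map_sum, map_mul, map_prod, map_pow, eval_C, eval_X, hKx,
        ← Finset.mul_sum, hlamsum] at h
      linarith
    have hvertex : ∀ j, 0 < ∏ i, x i ^ α j i := fun j =>
      Finset.prod_pos fun i _ => (hαeven j i).pow_pos (hxne i)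
    have hscaled := ((isSumSq_agiform α haff hH y lam (fun j => (hlam j).le) hlamsum hy).map
      (aeval fun i => (x i)⁻¹ • (X i : MvPolynomial (Fin n) ℝ))).smul_nonneg htpos.le
    have hrest : IsSumSq (∑ j, ((K - t) * lam j * (∏ i, x i ^ α j i)⁻¹) • xpow (α j)) :=
      IsSumSq.sum fun j _ => (isSumSq_xpow (hαeven j)).smul_nonneg
        (mul_nonneg (mul_nonneg (sub_nonneg.2 htK) (hlam j).le) (inv_nonneg.2 (hvertex j).le))
    suffices h : f = _ from h ▸ hscaled.add hrest
    simp only [map_sub, map_sum, map_smul,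
      aeval_scale_xpow, inv_pow, Finset.prod_inv_distrib, smul_sub, Finset.smul_sum, smul_smul]
    rw [hf', sub_add_eq_add_sub, ← Finset.sum_add_distrib, sub_eq_add_neg, ← neg_smul]
    congr 1
    · refine Finset.sum_congr rfl fun j _ => ?_
      rw [← add_smul]
      congr 1
      rw [← mul_inv_cancel_right₀ (hvertex j).ne' (b j), hKx]
      ring
    · congr 1
      rw [ht, neg_mul, neg_neg, mul_inv_cancel_right₀ (hxpow y)]
  · rintro ⟨m, q, rfl⟩ x
    rw [map_sum]
    exact Finset.sum_nonneg fun i _ => by rw [map_pow]; exact sq_nonneg _
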